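/- Suppose 2 < n ≤ ω, θ ≤ μ ≤ λ < 2^θ, and there is a coloring c : [λ]^{<n} → θ witnessing λ ↛ [μ]^{<n}_θ, i.e., for every A ∈ [λ]^μ the restriction of c to [A]^{<n} is onto θ. Let T_n be the theory of structures with, for each k with 2 ≤ k < n, an irreflexive k-place relation P_k. If T_n has a universal model of cardinality λ (universal under embeddings among models of T_n of cardinality λ), then there exists a family 𝒜 ⊆ [λ]^λ of cardinality 2^θ that is μ-almost-disjoint, i.e., any two distinct members of 𝒜 have intersection of cardinality < μ. -/

import Mathlib

open Cardinal

/-- if `2 < n ≤ ω`, `θ ≤ μ ≤ λ < 2^θ`, a coloring witnesses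
`λ ↛ [μ]^{<n}_θ`, and the theory `T_n` of irreflexive `k`-ary relations
(`2 ≤ k < n`) has a universal model of cardinality `λ`, then there is a
`μ`-almost-disjoint family `𝒜 ⊆ [λ]^λ` of cardinality `2^θ`. -/
theorem stmt3 (n : ℕ∞) (hn : 2 < n) (θ μ lam : Cardinal)
    (hθ : ℵ₀ ≤ θ) (hthmu : θ ≤ μ) (hmulam : μ ≤ lam) (hlam : lam < 2 ^ θ)
    (V β : Type) (hV : Cardinal.mk V = lam) (hβ : Cardinal.mk β = θ)
    -- a coloring witnessing `λ ↛ [μ]^{<n}_θ`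
    (c : Finset V → β)
    (hc : ∀ A : Set V, Cardinal.mk A = μ → ∀ t : β,
      ∃ s : Finset V, ↑s ⊆ A ∧ (s.card : ℕ∞) < n ∧ c s = t)
    -- a universal model `M* = (V, R)` of `T_n` of cardinality `λ`
    (R : ∀ k : ℕ, (Fin k → V) → Prop)
    (hR : ∀ k η, R k η → 2 ≤ k ∧ (k : ℕ∞) < n ∧ Function.Injective η)
    (huniv : ∀ (W : Type) (R' : ∀ k : ℕ, (Fin k → W) → Prop),
      Cardinal.mk W = lam →
      (∀ k η, R' k η → 2 ≤ k ∧ (k : ℕ∞) < n ∧ Function.Injective η) →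
      ∃ f : W → V, Function.Injective f ∧ ∀ k η, R' k η ↔ R k (f ∘ η)) :
    ∃ 𝒜 : Set (Set V), Cardinal.mk 𝒜 = 2 ^ θ ∧
      (∀ A ∈ 𝒜, Cardinal.mk A = lam) ∧
      (∀ A ∈ 𝒜, ∀ B ∈ 𝒜, A ≠ B → Cardinal.mk ↥(A ∩ B) < μ) := by
  classical
  have hmu : ℵ₀ ≤ μ := hθ.trans hthmu
  have hVinf : ℵ₀ ≤ Cardinal.mk V := by rw [hV]; exact hmu.trans hmulam
  have hβinf : ℵ₀ ≤ Cardinal.mk β := by rw [hβ]; exact hθ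
  obtain ⟨pr⟩ : Nonempty (V × V ≃ V) := by
    rw [← Cardinal.eq, Cardinal.mk_prod, Cardinal.lift_id, Cardinal.mul_eq_self hVinf]
  obtain ⟨e⟩ : Nonempty (β ≃ β × (Bool × Bool)) := by
    rw [← Cardinal.eq, Cardinal.mk_prod, Cardinal.lift_id, Cardinal.lift_id]
    refine (Cardinal.mul_eq_left hβinf ?_ ?_).symm
    · exact (Cardinal.mk_lt_aleph0.le).trans hβinf
    · exact Cardinal.mk_ne_zero _
  -- every set of size `μ` realizes all first coordinates on finite sets of size at least two
  have key : ∀ A : Set V, Cardinal.mk A = μ → ∀ t : β,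
      ∃ s : Finset V, ↑s ⊆ A ∧ 2 ≤ s.card ∧ (s.card : ℕ∞) < n ∧ (e (c s)).1 = t := by
    intro A hA t
    have hsplit : ∃ i : Bool, Cardinal.mk ↥{a ∈ A | (e (c {a})).2.1 = i} = μ := by
      by_contra! hcon
      have hlt : ∀ i : Bool, Cardinal.mk ↥{a ∈ A | (e (c {a})).2.1 = i} < μ := fun i =>
        lt_of_le_of_ne (hA ▸ Cardinal.mk_le_mk_of_subset (Set.sep_subset _ _)) (hcon i)
      have hun : A = {a ∈ A | (e (c {a})).2.1 = true} ∪ {a ∈ A | (e (c {a})).2.1 = false} := by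
        ext a
        simp only [Set.mem_union, Set.mem_setOf_eq]
        cases (e (c {a})).2.1 <;> simp
      have h1 := Cardinal.mk_union_le {a ∈ A | (e (c {a})).2.1 = true}
        {a ∈ A | (e (c {a})).2.1 = false}
      rw [← hun, hA] at h1
      exact absurd (Cardinal.add_lt_of_lt hmu (hlt true) (hlt false)) (not_lt.mpr h1)
    obtain ⟨i, hi⟩ := hsplit
    obtain ⟨s, hsA, hsn, hs⟩ := hc _ hi (e.symm (t, !i, !(e (c ∅)).2.2))
    have hes : e (c s) = (t, !i, !(e (c ∅)).2.2) := by rw [hs, Equiv.apply_symm_apply]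
    refine ⟨s, fun a ha => (hsA ha).1, ?_, hsn, by rw [hes]⟩
    by_contra hcard
    have h01 : s.card = 0 ∨ s.card = 1 := by omega
    rcases h01 with h0 | h1
    · rw [Finset.card_eq_zero] at h0
      subst h0
      have := congrArg (fun p => p.2.2) hes
      simp at this
    · rw [Finset.card_eq_one] at h1
      obtain ⟨a, rfl⟩ := h1
      have h2 : (e (c {a})).2.1 = i := (hsA (by simp)).2
      rw [hes] at h2
      simp at h2
  -- the models
  have hmod : ∀ X : Set β, ∃ f : V → V, Function.Injective f ∧ ∀ k (η : Fin k → V),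
      (2 ≤ k ∧ (k : ℕ∞) < n ∧ Function.Injective η ∧ (e (c (Finset.univ.image η))).1 ∈ X) ↔
        R k (f ∘ η) := fun X =>
    huniv V (fun k η => 2 ≤ k ∧ (k : ℕ∞) < n ∧ Function.Injective η ∧
      (e (c (Finset.univ.image η))).1 ∈ X) hV (fun k η h => ⟨h.1, h.2.1, h.2.2.1⟩)
  choose f hf hfR using hmod
  let G : Set β → Set V := fun X => Set.range fun a => pr (a, f X a)
  have hG : ∀ X, Cardinal.mk (G X) = lam := by
    intro X
    rw [← hV]
    refine Cardinal.mk_range_eq _ ?_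
    intro a b hab
    exact congrArg Prod.fst (pr.injective hab)
  have main : ∀ X Y, μ ≤ Cardinal.mk ↥(G X ∩ G Y) → X = Y := by
    intro X Y hXY
    let B : Set V := {a | f X a = f Y a}
    have hsub : G X ∩ G Y ⊆ (fun a => pr (a, f X a)) '' B := by
      rintro v ⟨⟨a, rfl⟩, ⟨b, hb⟩⟩
      have hp := pr.injective hb
      have h1 : b = a := congrArg Prod.fst hp
      subst h1
      exact ⟨b, (congrArg Prod.snd hp).symm, rfl⟩
    have hB : μ ≤ Cardinal.mk B :=
      hXY.trans ((Cardinal.mk_le_mk_of_subset hsub).trans Cardinal.mk_image_le)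
    obtain ⟨A, hAB, hA⟩ := Cardinal.le_mk_iff_exists_subset.mp hB
    ext t
    obtain ⟨s, hsA, hs2, hsn, hst⟩ := key A hA t
    let η : Fin s.card → V := fun j => (s.equivFin.symm j : V)
    have hη : Function.Injective η := Subtype.val_injective.comp s.equivFin.symm.injective
    have him : Finset.univ.image η = s := by
      ext v
      simp only [Finset.mem_image, Finset.mem_univ, true_and]
      constructor
      · rintro ⟨j, rfl⟩
        exact (s.equivFin.symm j).2
      · intro hv
        exact ⟨s.equivFin ⟨v, hv⟩, by simp [η]⟩
    have hcomp : f X ∘ η = f Y ∘ η := by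
      funext j
      exact hAB (hsA (s.equivFin.symm j).2)
    have h1 := hfR X s.card η
    have h2 := hfR Y s.card η
    rw [hcomp, ← h2, him, hst] at h1
    constructor
    · intro h
      exact (h1.mp ⟨hs2, hsn, hη, h⟩).2.2.2
    · intro h
      exact (h1.mpr ⟨hs2, hsn, hη, h⟩).2.2.2
  refine ⟨Set.range G, ?_, ?_, ?_⟩
  · rw [Cardinal.mk_range_eq, Cardinal.mk_set, hβ]
    intro X Y hXY
    apply main
    rw [hXY, Set.inter_self, hG]
    exact hmulam
  · rintro _ ⟨X, rfl⟩
    exact hG X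
  · rintro _ ⟨X, rfl⟩ _ ⟨Y, rfl⟩ hne
    by_contra hcon
    exact hne (congrArg G (main X Y (not_lt.mp hcon)))
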